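/- For every Bell-local bipartite model, the correlators satisfy −1 ≤ ⟨a¹_0 (a²_0 + a²_1)/2⟩ + ⟨a¹_1 (a²_0 − a²_1)/2⟩ ≤ 1 (the CHSH inequality). -/

import Mathlib

open MeasureTheory

/-- **CHSH inequality.** For every Bell-local bipartite model (a probability space `(Λ, ρ)`
with measurable ±1-valued response functions `a¹, a² : {0,1} × Λ → {−1,1}`, correlators being
`⟨a¹_{x¹} a²_{x²}⟩ = ∫ a¹(x¹,λ) a²(x²,λ) dρ(λ)`), one has
`−1 ≤ ⟨a¹_0 (a²_0 + a²_1)/2⟩ + ⟨a¹_1 (a²_0 − a²_1)/2⟩ ≤ 1`. -/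
theorem chsh_inequality
    {Λ : Type} [MeasurableSpace Λ] (ρ : Measure Λ) [IsProbabilityMeasure ρ]
    (a₁ a₂ : Fin 2 → Λ → ℝ)
    (ha₁_meas : ∀ x, Measurable (a₁ x)) (ha₂_meas : ∀ x, Measurable (a₂ x))
    (ha₁_val : ∀ x lam, a₁ x lam = 1 ∨ a₁ x lam = -1)
    (ha₂_val : ∀ x lam, a₂ x lam = 1 ∨ a₂ x lam = -1) :
    -1 ≤ (∫ lam, a₁ 0 lam * ((a₂ 0 lam + a₂ 1 lam) / 2) ∂ρ)
          + (∫ lam, a₁ 1 lam * ((a₂ 0 lam - a₂ 1 lam) / 2) ∂ρ)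
      ∧ (∫ lam, a₁ 0 lam * ((a₂ 0 lam + a₂ 1 lam) / 2) ∂ρ)
          + (∫ lam, a₁ 1 lam * ((a₂ 0 lam - a₂ 1 lam) / 2) ∂ρ) ≤ 1 := by
  have hf : Integrable (fun lam => a₁ 0 lam * ((a₂ 0 lam + a₂ 1 lam) / 2)) ρ := by
    refine Integrable.of_bound (C := 1) (by fun_prop) (.of_forall fun lam => ?_)
    rcases ha₁_val 0 lam with h | h <;> rcases ha₂_val 0 lam with h' | h' <;>
      rcases ha₂_val 1 lam with h'' | h'' <;> norm_num [h, h', h'']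
  have hg : Integrable (fun lam => a₁ 1 lam * ((a₂ 0 lam - a₂ 1 lam) / 2)) ρ := by
    refine Integrable.of_bound (C := 1) (by fun_prop) (.of_forall fun lam => ?_)
    rcases ha₁_val 1 lam with h | h <;> rcases ha₂_val 0 lam with h' | h' <;>
      rcases ha₂_val 1 lam with h'' | h'' <;> norm_num [h, h', h'']
  rw [← integral_add hf hg, ← abs_le, ← Real.norm_eq_abs]
  refine (norm_integral_le_of_norm_le_const (C := 1) (.of_forall fun lam => ?_)).trans_eq
    (by simp)
  rcases ha₁_val 0 lam with h | h <;> rcases ha₁_val 1 lam with k | k <;>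
    rcases ha₂_val 0 lam with h' | h' <;> rcases ha₂_val 1 lam with h'' | h'' <;>
    norm_num [h, k, h', h'']
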